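/- arXiv:1201.2690 — 2 statements merged into one kernel-verified Lean document; each statement's English description precedes it below -/
import Mathlib

section
/- Let P be a probability measure on a measurable space (Ω, ℱ) and let ξ : Ω → ℝ be measurable with e^{−ξ} ∈ L¹(P) and ξ e^{−ξ} ∈ L¹(P); set c := ∫_Ω e^{−ξ} dP. Define the probability measure Q* by dQ*/dP = e^{−ξ}/c. Then: (i) Q* is a probability measure equivalent to P (i.e., Q* ≪ P and P ≪ Q*); (ii) ξ ∈ L¹(Q*), H(Q*|P) < ∞, and ∫_Ω ξ dQ* + H(Q*|P) = −log c; (iii) Q* is the unique minimizer: if Q is any probability measure with Q ≪ P, H(Q|P) < ∞, ξ ∈ L¹(Q) and ∫_Ω ξ dQ + H(Q|P) = −log c, then Q = Q*. -/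
open MeasureTheory

/-- The relative entropy (Kullback–Leibler divergence) `H(Q|P) = ∫ log(dQ/dP) dQ`,
as a real number (meaningful when `Q ≪ P` and the log-likelihood ratio is `Q`-integrable). -/
noncomputable def relEntropy {Ω : Type*} [MeasurableSpace Ω] (Q P : Measure Ω) : ℝ :=
  ∫ x, Real.log ((Q.rnDeriv P x).toReal) ∂Q

/-- The Gibbs measure `dQ*/dP = e^{-ξ}/c`, with `c = ∫ e^{-ξ} dP`, is a probability
measure equivalent to `P`; it satisfies `ξ ∈ L¹(Q*)`, `H(Q*|P) < ∞` and
`∫ ξ dQ* + H(Q*|P) = -log c`; and it is the unique probability measure `Q ≪ P` with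
finite entropy and `ξ ∈ L¹(Q)` attaining the value `-log c`. -/
theorem gibbs_measure_unique_minimizer {Ω : Type*} [MeasurableSpace Ω]
    (P : Measure Ω) [IsProbabilityMeasure P]
    (ξ : Ω → ℝ) (hξm : Measurable ξ)
    (hexp : Integrable (fun x => Real.exp (-ξ x)) P)
    (hxexp : Integrable (fun x => ξ x * Real.exp (-ξ x)) P)
    (c : ℝ) (hc : c = ∫ x, Real.exp (-ξ x) ∂P)
    (Qstar : Measure Ω)
    (hQstar : Qstar = P.withDensity (fun x => ENNReal.ofReal (Real.exp (-ξ x) / c))) :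
    (IsProbabilityMeasure Qstar ∧ Qstar ≪ P ∧ P ≪ Qstar) ∧
    (Integrable ξ Qstar ∧
      Integrable (fun x => Real.log ((Qstar.rnDeriv P x).toReal)) Qstar ∧
      ∫ x, ξ x ∂Qstar + relEntropy Qstar P = -Real.log c) ∧
    (∀ Q : Measure Ω, IsProbabilityMeasure Q → Q ≪ P →
      Integrable (fun x => Real.log ((Q.rnDeriv P x).toReal)) Q →
      Integrable ξ Q →
      ∫ x, ξ x ∂Q + relEntropy Q P = -Real.log c → Q = Qstar) := by
  have htilted : Qstar = P.tilted (fun x => -ξ x) := by rw [hQstar, hc, Measure.tilted]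
  subst htilted
  have hprob : IsProbabilityMeasure (P.tilted fun x => -ξ x) := isProbabilityMeasure_tilted hexp
  have hac : P.tilted (fun x => -ξ x) ≪ P := tilted_absolutelyContinuous P _
  have hac' : P ≪ P.tilted (fun x => -ξ x) := absolutelyContinuous_tilted hexp
  have hξ : Integrable ξ (P.tilted fun x => -ξ x) := by
    rw [integrable_tilted_iff hexp]
    simpa [mul_comm] using hxexp
  have hlog : (fun x => Real.log (((P.tilted fun x => -ξ x).rnDeriv P x).toReal))
      =ᵐ[P.tilted fun x => -ξ x] fun x => -ξ x - Real.log c := by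
    rw [hc]
    exact hac.ae_eq (log_rnDeriv_tilted_left_self hexp)
  refine ⟨⟨hprob, hac, hac'⟩, ⟨hξ, ?_, ?_⟩, fun Q _ hQ hllr hξQ hval => ?_⟩
  · exact (hξ.neg.sub (integrable_const _)).congr hlog.symm
  · rw [relEntropy, integral_congr_ae hlog, integral_sub (f := fun x => -ξ x) hξ.neg (integrable_const _),
      integral_neg, integral_const, probReal_univ, one_smul]
    ring
  · have hQac : Q ≪ P.tilted (fun x => -ξ x) := hQ.trans hac'
    have hfin := InformationTheory.klDiv_ne_top hQac
      (integrable_llr_tilted_right hQ hξQ.neg hllr hexp)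
    have hzero : (InformationTheory.klDiv Q (P.tilted fun x => -ξ x)).toReal = 0 := by
      have hint := integral_llr_tilted_right (f := fun x => -ξ x) hQ hξQ.neg hexp hllr
      rw [integral_neg, ← hc] at hint
      rw [InformationTheory.toReal_klDiv_of_measure_eq hQac (by simp), hint]
      simp only [relEntropy] at hval
      simp only [llr_def]
      linarith
    exact InformationTheory.klDiv_eq_zero_iff.mp
      ((ENNReal.toReal_eq_zero_iff _).mp hzero |>.resolve_right hfin)
end

section
/- Let (α, 𝒜, μ) be a measure space with μ ≠ 0, let h : α → ℝ be measurable with h > 0 μ-almost everywhere, and let I : (0,∞) → (0,∞) be continuous, strictly decreasing, with I(u) → +∞ as u → 0⁺ and I(u) → 0 as u → +∞. Assume that for every ν > 0 the function x ↦ I(ν·h(x)) is μ-integrable. Define f : (0,∞) → ℝ by f(ν) := ∫ I(ν·h(x)) dμ(x). Then f is continuous and strictly decreasing on (0,∞), f(ν) → +∞ as ν → 0⁺, and f(ν) → 0 as ν → +∞; consequently, for every x > 0 there exists a unique ν⁰ > 0 with f(ν⁰) = x. -/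
open MeasureTheory Filter

/-- An a.e. positive function on a nonzero measure space is bounded by some natural number on a
set of nonzero measure. -/
theorem exists_measure_pos_and_le_natCast_ne_zero {α : Type*} [MeasurableSpace α] {μ : Measure α}
    (hμ : μ ≠ 0) {h : α → ℝ} (hpos : ∀ᵐ x ∂μ, 0 < h x) :
    ∃ n : ℕ, μ {x | 0 < h x ∧ h x ≤ n} ≠ 0 := by
  by_contra! hzero
  have hnot : ∀ᵐ x ∂μ, ∀ n : ℕ, ¬(0 < h x ∧ h x ≤ n) :=
    ae_all_iff.2 fun n => measure_eq_zero_iff_ae_notMem.1 (hzero n)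
  have hfalse : ∀ᵐ _ ∂μ, False := by
    filter_upwards [hpos, hnot] with x hx hn
    obtain ⟨n, hle⟩ := exists_nat_ge (h x)
    exact hn n ⟨hx, hle⟩
  exact hμ (ae_eq_bot.1 (eventually_false_iff_eq_bot.1 hfalse))

/-- A continuous strictly antitone function on `(0, ∞)` with limits `+∞` at `0⁺` and `0` at `+∞`
takes every positive value exactly once. -/
theorem existsUnique_eq_of_strictAntiOn_Ioi {f : ℝ → ℝ} (hcont : ContinuousOn f (Set.Ioi 0))
    (hanti : StrictAntiOn f (Set.Ioi 0)) (hzero : Tendsto f (nhdsWithin 0 (Set.Ioi 0)) atTop)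
    (htop : Tendsto f atTop (nhds 0)) {y : ℝ} (hy : 0 < y) :
    ∃! ν : ℝ, 0 < ν ∧ f ν = y := by
  obtain ⟨a, hya, ha⟩ := ((hzero.eventually_ge_atTop y).and self_mem_nhdsWithin).exists
  obtain ⟨b, hby, hb⟩ :=
    ((htop.eventually_lt_const hy).and (eventually_gt_atTop (0 : ℝ))).exists
  obtain ⟨ν, hν, hfν⟩ := isPreconnected_Ioi.intermediate_value hb ha hcont ⟨hby.le, hya⟩
  exact ⟨ν, ⟨hν, hfν⟩, fun ν' hν' => hanti.injOn hν'.1 hν (hν'.2.trans hfν.symm)⟩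

/-- The budget map of Theorem 5: on a nonzero measure space, if `h > 0` a.e. and
`I : (0,∞) → (0,∞)` is continuous, strictly decreasing with `I(0⁺) = +∞`, `I(∞) = 0`,
and `x ↦ I(ν h(x))` is integrable for each `ν > 0`, then
`f(ν) = ∫ I(ν h(x)) dμ(x)` is continuous and strictly decreasing on `(0,∞)`, tends to
`+∞` at `0⁺` and to `0` at `+∞`; consequently for every `x > 0` there is a unique
`ν⁰ > 0` with `f(ν⁰) = x`. -/
theorem budget_map_bijective {α : Type*} [MeasurableSpace α] (μ : Measure α) (hμ : μ ≠ 0)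
    (h : α → ℝ) (hhm : Measurable h) (hhpos : ∀ᵐ x ∂μ, 0 < h x)
    (I : ℝ → ℝ)
    (hIcont : ContinuousOn I (Set.Ioi 0))
    (hIanti : StrictAntiOn I (Set.Ioi 0))
    (hIpos : ∀ u ∈ Set.Ioi (0 : ℝ), 0 < I u)
    (hI0 : Tendsto I (nhdsWithin 0 (Set.Ioi 0)) atTop)
    (hIinfty : Tendsto I atTop (nhds 0))
    (hint : ∀ ν : ℝ, 0 < ν → Integrable (fun x => I (ν * h x)) μ)
    (f : ℝ → ℝ) (hf : ∀ ν : ℝ, f ν = ∫ x, I (ν * h x) ∂μ) :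
    ContinuousOn f (Set.Ioi 0) ∧
    StrictAntiOn f (Set.Ioi 0) ∧
    Tendsto f (nhdsWithin 0 (Set.Ioi 0)) atTop ∧
    Tendsto f atTop (nhds 0) ∧
    ∀ x : ℝ, 0 < x → ∃! ν : ℝ, 0 < ν ∧ f ν = x := by
  obtain rfl : f = fun ν => ∫ x, I (ν * h x) ∂μ := funext hf
  have hnonneg : ∀ ν : ℝ, 0 < ν → ∀ᵐ x ∂μ, 0 ≤ I (ν * h x) := fun ν hν => by
    filter_upwards [hhpos] with x hx using (hIpos _ (mul_pos hν hx)).le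
  have hbound : ∀ a ν : ℝ, 0 < a → a ≤ ν → ∀ᵐ x ∂μ, ‖I (ν * h x)‖ ≤ I (a * h x) :=
    fun a ν ha haν => by
      filter_upwards [hhpos] with x hx
      have hν : 0 < ν * h x := mul_pos (ha.trans_le haν) hx
      rw [Real.norm_of_nonneg (hIpos _ hν).le]
      exact hIanti.antitoneOn (mul_pos ha hx) hν (by gcongr)
  have hcont : ContinuousOn (fun ν => ∫ x, I (ν * h x) ∂μ) (Set.Ioi 0) := by
    intro ν (hν : 0 < ν)
    refine (continuousAt_of_dominated (bound := fun x => I (ν / 2 * h x)) ?_ ?_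
      (hint _ (half_pos hν)) ?_).continuousWithinAt
    · filter_upwards [lt_mem_nhds hν] with ξ hξ using (hint ξ hξ).aestronglyMeasurable
    · filter_upwards [lt_mem_nhds (half_lt_self hν)] with ξ hξ
        using hbound _ _ (half_pos hν) hξ.le
    · filter_upwards [hhpos] with x hx
      exact ContinuousAt.comp' (hIcont.continuousAt (Ioi_mem_nhds (mul_pos hν hx)))
        (continuousAt_id.mul continuousAt_const)
  have hanti : StrictAntiOn (fun ν => ∫ x, I (ν * h x) ∂μ) (Set.Ioi 0) := by
    intro a (ha : 0 < a) b (hb : 0 < b) hab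
    have hlt : ∀ᵐ x ∂μ, I (b * h x) < I (a * h x) := by
      filter_upwards [hhpos] with x hx
      exact hIanti (mul_pos ha hx) (mul_pos hb hx) (by gcongr)
    have hle : (fun x => I (b * h x)) ≤ᵐ[μ] fun x => I (a * h x) := hlt.mono fun _ => le_of_lt
    refine (integral_mono_ae (hint b hb) (hint a ha) hle).lt_of_ne fun heq => hμ ?_
    have hfalse : ∀ᵐ _ ∂μ, False := by
      filter_upwards [hlt, (integral_eq_iff_of_ae_le (hint b hb) (hint a ha) hle).1 heq]
        with x hx hx' using hx.ne hx'
    exact ae_eq_bot.1 (eventually_false_iff_eq_bot.1 hfalse)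
  have hzero : Tendsto (fun ν => ∫ x, I (ν * h x) ∂μ) (nhdsWithin 0 (Set.Ioi 0)) atTop := by
    obtain ⟨n, hn⟩ := exists_measure_pos_and_le_natCast_ne_zero hμ hhpos
    set A := {x | 0 < h x ∧ h x ≤ n}
    have hn0 : (0 : ℝ) < n := by
      obtain ⟨x, hx⟩ := nonempty_of_measure_ne_zero hn
      exact hx.1.trans_le hx.2
    have hsub : ∀ ν : ℝ, 0 < ν → A ⊆ {x | I (ν * n) ≤ I (ν * h x)} := fun ν hν x hx =>
      hIanti.antitoneOn (mul_pos hν hx.1) (mul_pos hν hn0) (mul_le_mul_of_nonneg_left hx.2 hν.le)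
    have hfin : ∀ ν : ℝ, 0 < ν → μ {x | I (ν * n) ≤ I (ν * h x)} < ⊤ := fun ν hν =>
      (hint ν hν).measure_ge_lt_top (hIpos _ (mul_pos hν hn0))
    have hA : 0 < μ.real A :=
      ENNReal.toReal_pos hn ((measure_mono (hsub 1 one_pos)).trans_lt (hfin 1 one_pos)).ne
    have hscale : Tendsto (fun ν : ℝ => ν * n) (nhdsWithin 0 (Set.Ioi 0))
        (nhdsWithin 0 (Set.Ioi 0)) := by
      refine tendsto_nhdsWithin_iff.2 ⟨?_, ?_⟩
      · exact ((continuous_mul_const (n : ℝ)).tendsto' 0 0 (zero_mul _)).mono_left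
          nhdsWithin_le_nhds
      · filter_upwards [self_mem_nhdsWithin] with ν hν using mul_pos hν hn0
    refine tendsto_atTop_mono' _ ?_ ((hI0.comp hscale).atTop_mul_const hA)
    filter_upwards [self_mem_nhdsWithin] with ν (hν : 0 < ν)
    calc I (ν * n) * μ.real A
        ≤ I (ν * n) * μ.real {x | I (ν * n) ≤ I (ν * h x)} :=
          mul_le_mul_of_nonneg_left (measureReal_mono (hsub ν hν) (hfin ν hν).ne)
            (hIpos _ (mul_pos hν hn0)).le
      _ ≤ ∫ x, I (ν * h x) ∂μ := mul_meas_ge_le_integral_of_nonneg (hnonneg ν hν) (hint ν hν) _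
  have htop : Tendsto (fun ν => ∫ x, I (ν * h x) ∂μ) atTop (nhds 0) := by
    rw [← integral_zero α ℝ (μ := μ)]
    refine tendsto_integral_filter_of_dominated_convergence (fun x => I (1 * h x)) ?_ ?_
      (hint 1 one_pos) ?_
    · filter_upwards [eventually_gt_atTop 0] with ν hν using (hint ν hν).aestronglyMeasurable
    · filter_upwards [eventually_ge_atTop 1] with ν hν using hbound 1 ν one_pos hν
    · filter_upwards [hhpos] with x hx
      exact hIinfty.comp (tendsto_id.atTop_mul_const hx)
  exact ⟨hcont, hanti, hzero, htop, fun _ hx =>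
    existsUnique_eq_of_strictAntiOn_Ioi hcont hanti hzero htop hx⟩
end
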